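/- Let (α,θ) ∈ Ω and let φ, β, G, U be as in the context. Then α·G(U) + C·β(U) = L(α,θ). In particular, if L(α,θ) = 0 then α·G(U) + C·β(U) = 0. -/

import Mathlib

open Real Filter

noncomputable def Ccoef (α θ : ℝ) : ℝ := Real.sin (2 * θ) / (2 * α)

noncomputable def Ppoly (α θ x : ℝ) : ℝ :=
  α ^ 2 + Real.cos (2 * θ) * x ^ 2 - Ccoef α θ ^ 2 * x ^ 4

noncomputable def thetaPlus (α : ℝ) : ℝ :=
  if 1 < α then Real.pi / 2 else (1 / 2) * Real.arccos (1 - 2 * α ^ 2)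

def inOmega (α θ : ℝ) : Prop := 0 < α ∧ -thetaPlus α < θ ∧ θ < thetaPlus α

noncomputable def Lint (α θ : ℝ) : ℝ :=
  ∫ x in (-1 : ℝ)..1,
    (2 * α * Ccoef α θ ^ 2 * x ^ 2 - α * Real.cos (2 * θ)
        + Ccoef α θ ^ 2 * x ^ 2 * Real.sqrt (Ppoly α θ x)) /
      (Real.sqrt ((1 - x ^ 2) * Ppoly α θ x) * (α + Real.sqrt (Ppoly α θ x)))

/-- Wirtinger derivative `f_z = (f_u - i f_v)/2` of a map `f : ℝ² → ℂ`. -/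
noncomputable def wz (f : ℝ × ℝ → ℂ) (p : ℝ × ℝ) : ℂ :=
  (deriv (fun t => f (t, p.2)) p.1 - Complex.I * deriv (fun t => f (p.1, t)) p.2) / 2

/-- Wirtinger derivative `f_z̄ = (f_u + i f_v)/2` of a map `f : ℝ² → ℂ`. -/
noncomputable def wzbar (f : ℝ × ℝ → ℂ) (p : ℝ × ℝ) : ℂ :=
  (deriv (fun t => f (t, p.2)) p.1 + Complex.I * deriv (fun t => f (p.1, t)) p.2) / 2

theorem one_sub_lt_cos_of_inOmega {α θ : ℝ} (h : inOmega α θ) :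
    1 - 2 * α ^ 2 < Real.cos (2 * θ) := by
  obtain ⟨hα, h₁, h₂⟩ := h
  unfold thetaPlus at h₁ h₂
  split_ifs at h₁ h₂ with hlt
  · nlinarith [Real.neg_one_le_cos (2 * θ)]
  · have hle : α ≤ 1 := not_lt.mp hlt
    have habs : |2 * θ| < Real.arccos (1 - 2 * α ^ 2) := by
      rw [abs_lt]
      constructor <;> linarith
    have := Real.cos_lt_cos_of_nonneg_of_le_pi (abs_nonneg _) (Real.arccos_le_pi _) habs
    rwa [Real.cos_abs, Real.cos_arccos (by nlinarith) (by nlinarith)] at this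

theorem Ppoly_pos {α θ : ℝ} (h : inOmega α θ) {x : ℝ} (hx : x ^ 2 ≤ 1) :
    0 < Ppoly α θ x := by
  have hα := h.1
  have hcos := one_sub_lt_cos_of_inOmega h
  have hC : 4 * α ^ 2 * Ccoef α θ ^ 2 = 1 - Real.cos (2 * θ) ^ 2 := by
    have := Real.sin_sq_add_cos_sq (2 * θ)
    rw [Ccoef]
    field_simp
    linarith
  have hend : 0 < α ^ 2 + Real.cos (2 * θ) - Ccoef α θ ^ 2 := by
    have hα2 : 0 < 4 * α ^ 2 := by positivity
    refine pos_of_mul_pos_right (a := 4 * α ^ 2) ?_ hα2.le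
    nlinarith [mul_pos (sub_pos.mpr hcos)
      (show 0 < 2 * α ^ 2 + Real.cos (2 * θ) + 1 by
        nlinarith [Real.neg_one_le_cos (2 * θ)])]
  unfold Ppoly
  have hx0 := sq_nonneg x
  have hα2 : 0 < α ^ 2 := by positivity
  have hmul := mul_nonneg hx0 (sub_nonneg.mpr hx)
  have := mul_nonneg (sq_nonneg (Ccoef α θ)) hmul
  rcases hx.eq_or_lt with hx1 | hx1
  · have : x ^ 4 = 1 := by rw [show x ^ 4 = (x ^ 2) ^ 2 by ring, hx1, one_pow]
    rw [hx1, this]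
    linarith
  · nlinarith [mul_pos hα2 (sub_pos.mpr hx1), mul_nonneg hx0 hend.le]

theorem Ppoly_cos_pos {α θ : ℝ} (h : inOmega α θ) (t : ℝ) : 0 < Ppoly α θ (Real.cos t) :=
  Ppoly_pos h (Real.cos_sq_le_one t)

theorem continuous_Ppoly (α θ : ℝ) : Continuous (Ppoly α θ) := by
  unfold Ppoly
  fun_prop

/-- The integrand of `Lint` without the factor `1 / √(1 - x²)`. -/
noncomputable def angularDensity (α θ x : ℝ) : ℝ :=
  (2 * α * Ccoef α θ ^ 2 * x ^ 2 - α * Real.cos (2 * θ)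
      + Ccoef α θ ^ 2 * x ^ 2 * Real.sqrt (Ppoly α θ x)) /
    (Real.sqrt (Ppoly α θ x) * (α + Real.sqrt (Ppoly α θ x)))

theorem continuous_angularDensity_cos {α θ : ℝ} (h : inOmega α θ) :
    Continuous fun t => angularDensity α θ (Real.cos t) := by
  have hP : Continuous fun t => Real.sqrt (Ppoly α θ (Real.cos t)) :=
    ((continuous_Ppoly α θ).comp Real.continuous_cos).sqrt
  unfold angularDensity
  refine Continuous.div (by fun_prop) (by fun_prop) fun t => ?_
  have := h.1
  have := Real.sqrt_pos.mpr (Ppoly_cos_pos h t)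
  positivity

theorem Lint_eq_integral_cos (α θ : ℝ) :
    Lint α θ = ∫ t in (0 : ℝ)..Real.pi, angularDensity α θ (Real.cos t) := by
  rw [← Polynomial.Chebyshev.integral_measureT_eq_integral_cos,
    Polynomial.Chebyshev.integral_measureT, Lint]
  refine intervalIntegral.integral_congr fun x hx => ?_
  rw [Set.uIcc_of_le (by norm_num)] at hx
  have hx2 : 0 ≤ 1 - x ^ 2 := by nlinarith [hx.1, hx.2]
  simp only [angularDensity]
  rw [Real.sqrt_mul hx2, Real.sqrt_inv, ← div_eq_mul_inv, div_div,
    mul_comm (Real.sqrt (1 - x ^ 2)), mul_right_comm (Real.sqrt (Ppoly α θ x))]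

theorem eq_neg_sqrt_Ppoly {α θ : ℝ} (h : inOmega α θ) {φ φ' : ℝ → ℝ}
    (hφ'c : Continuous φ') (hode : ∀ u, (φ' u) ^ 2 = Ppoly α θ (Real.cos (φ u)))
    (hφ'0 : φ' 0 ≤ 0) (u : ℝ) : φ' u = -Real.sqrt (Ppoly α θ (Real.cos (φ u))) := by
  have hle : φ' u ≤ 0 := by
    by_contra! hu
    obtain ⟨v, hv⟩ := mem_range_of_exists_le_of_exists_ge hφ'c ⟨0, hφ'0⟩ ⟨u, hu.le⟩
    have := hode v
    rw [hv] at this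
    linarith [Ppoly_cos_pos h (φ v)]
  rw [← hode, Real.sqrt_sq_eq_abs, abs_of_nonpos hle, neg_neg]

/-- `α·G(U) + C·β(U) = L(α,θ)`; in particular if `L(α,θ) = 0` then `α·G(U) + C·β(U) = 0`. -/
theorem statement_11 {α θ : ℝ} (hΩ : inOmega α θ) (φ φ' β G : ℝ → ℝ)
    (hφ : ∀ u, HasDerivAt φ (φ' u) u) (hφ'c : Continuous φ')
    (hode : ∀ u, (φ' u) ^ 2 = Ppoly α θ (Real.cos (φ u)))
    (hφ0 : φ 0 = 0) (hφ'0 : φ' 0 ≤ 0)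
    (hβ : ∀ u, HasDerivAt β (Ccoef α θ * Real.cos (φ u) ^ 2) u) (hβ0 : β 0 = 0)
    (hG : ∀ u, HasDerivAt G
      ((Ccoef α θ ^ 2 * Real.cos (φ u) ^ 2 - Real.cos (2 * θ)) / (α - φ' u)) u)
    (hG0 : G 0 = 0)
    (U : ℝ) (hU : 0 < U) (hUper : ∀ u, φ (u + U) = φ u - Real.pi) :
    α * G U + Ccoef α θ * β U = Lint α θ ∧
    (Lint α θ = 0 → α * G U + Ccoef α θ * β U = 0) := by
  have hsqrt := eq_neg_sqrt_Ppoly hΩ hφ'c hode hφ'0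
  have hdens := continuous_angularDensity_cos hΩ
  have hφc : Continuous φ := continuous_iff_continuousAt.mpr fun u => (hφ u).continuousAt
  have hφU : φ U = -Real.pi := by simpa [hφ0] using hUper 0
  have hderiv : ∀ u, HasDerivAt (fun u => α * G u + Ccoef α θ * β u)
      (-angularDensity α θ (Real.cos (φ u)) * φ' u) u := by
    intro u
    refine (((hG u).const_mul α).add ((hβ u).const_mul (Ccoef α θ))).congr_deriv ?_
    have hα := hΩ.1
    have hs := Real.sqrt_pos.mpr (Ppoly_cos_pos hΩ (φ u))
    rw [hsqrt u, angularDensity, sub_neg_eq_add]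
    field_simp
    ring
  have hmain : α * G U + Ccoef α θ * β U = Lint α θ :=
    calc α * G U + Ccoef α θ * β U
        = ∫ u in (0 : ℝ)..U, -angularDensity α θ (Real.cos (φ u)) * φ' u := by
          rw [intervalIntegral.integral_eq_sub_of_hasDerivAt (fun u _ => hderiv u)
            (((hdens.comp hφc).neg.mul hφ'c).intervalIntegrable _ _)]
          simp [hG0, hβ0]
      _ = ∫ t in φ 0..φ U, -angularDensity α θ (Real.cos t) :=
          intervalIntegral.integral_comp_mul_deriv (fun u _ => hφ u) hφ'c.continuousOn hdens.neg
      _ = ∫ t in -Real.pi..-0, angularDensity α θ (Real.cos t) := by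
          rw [hφ0, hφU, intervalIntegral.integral_symm, intervalIntegral.integral_neg,
            neg_neg, neg_zero]
      _ = Lint α θ := by
          rw [Lint_eq_integral_cos, ← intervalIntegral.integral_comp_neg]
          simp only [Real.cos_neg]
  exact ⟨hmain, fun h => hmain.trans h⟩
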